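/- For an integer N ≥ 1 and real constants P > 0, a_n > 0, b_n ≥ 0, c_n > 0 (n = 1, …, N), the function ψ ↦ P / (Σ_{n=1}^{N} log(1 + a_n·ψ_n/(b_n·ψ_n + c_n))) is convex on the open positive orthant {ψ ∈ ℝ^N : ψ_n > 0 for all n}. -/

import Mathlib

/-- The reciprocal of a positive concave function is convex. -/
theorem ConcaveOn.convexOn_inv_of_pos {E : Type*} [AddCommMonoid E] [Module ℝ E] {s : Set E}
    {f : E → ℝ} (hf : ConcaveOn ℝ s f) (hpos : ∀ x ∈ s, 0 < f x) :
    ConvexOn ℝ s (fun x => (f x)⁻¹) := by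
  refine ⟨hf.1, fun x hx y hy u v hu hv huv => ?_⟩
  have hinv : ConvexOn ℝ (Set.Ioi 0) (fun r : ℝ => r⁻¹) := by
    simpa using convexOn_zpow (𝕜 := ℝ) (-1)
  have hmem : 0 < u • f x + v • f y :=
    (convex_Ioi (0 : ℝ)) (hpos x hx) (hpos y hy) hu hv huv
  exact (inv_anti₀ hmem (hf.2 hx hy hu hv huv)).trans
    (hinv.2 (hpos x hx) (hpos y hy) hu hv huv)

/-- The logarithm of a positive concave function is concave. -/
theorem ConcaveOn.log_of_pos {E : Type*} [AddCommMonoid E] [Module ℝ E] {s : Set E}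
    {f : E → ℝ} (hf : ConcaveOn ℝ s f) (hpos : ∀ x ∈ s, 0 < f x) :
    ConcaveOn ℝ s (fun x => Real.log (f x)) := by
  refine ⟨hf.1, fun x hx y hy u v hu hv huv => ?_⟩
  have hmem : 0 < u • f x + v • f y :=
    (convex_Ioi (0 : ℝ)) (hpos x hx) (hpos y hy) hu hv huv
  exact (strictConcaveOn_log_Ioi.concaveOn.2 (hpos x hx) (hpos y hy) hu hv huv).trans
    (Real.log_le_log hmem (hf.2 hx hy hu hv huv))

theorem concaveOn_mul_div_mul_add {a b c : ℝ} (ha : 0 ≤ a) (hb : 0 ≤ b) (hc : 0 < c) :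
    ConcaveOn ℝ (Set.Ioi 0) (fun x => a * x / (b * x + c)) := by
  refine ⟨convex_Ioi 0, fun x hx y hy u v hu hv huv => ?_⟩
  rw [Set.mem_Ioi] at hx hy
  have hX : 0 < b * x + c := by positivity
  have hY : 0 < b * y + c := by positivity
  have hZ : 0 < b * (u * x + v * y) + c := by positivity
  obtain rfl : v = 1 - u := by linarith
  simp only [smul_eq_mul]
  have key : a * (u * x + (1 - u) * y) / (b * (u * x + (1 - u) * y) + c)
      - (u * (a * x / (b * x + c)) + (1 - u) * (a * y / (b * y + c)))
      = a * b * c * u * (1 - u) * (x - y) ^ 2 /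
        ((b * x + c) * (b * y + c) * (b * (u * x + (1 - u) * y) + c)) := by
    field_simp
    ring
  rw [← sub_nonneg, key]
  positivity

/-- **Convexity of the device transmit-energy term in the fronthaul variables.**
For an integer `N ≥ 1` and real constants `P > 0`, `a_n > 0`, `b_n ≥ 0`,
`c_n > 0`, the function
`ψ ↦ P / (Σ_n log(1 + a_n·ψ_n/(b_n·ψ_n + c_n)))`
is convex on the open positive orthant `{ψ ∈ ℝ^N : ψ_n > 0 for all n}`. -/
theorem device_energy_convex
    (N : ℕ) (hN : 1 ≤ N) (P : ℝ) (hP : 0 < P)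
    (a b c : Fin N → ℝ)
    (ha : ∀ n, 0 < a n) (hb : ∀ n, 0 ≤ b n) (hc : ∀ n, 0 < c n) :
    ConvexOn ℝ {ψ : Fin N → ℝ | ∀ n, 0 < ψ n}
      (fun ψ => P / ∑ n : Fin N,
        Real.log (1 + a n * ψ n / (b n * ψ n + c n))) := by
  have hconv : Convex ℝ {ψ : Fin N → ℝ | ∀ n, 0 < ψ n} :=
    fun x hx y hy u v hu hv huv n => (convex_Ioi (0 : ℝ)) (hx n) (hy n) hu hv huv
  have hratio (n : Fin N) (ψ : Fin N → ℝ) (hψ : ∀ n, 0 < ψ n) :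
      0 < a n * ψ n / (b n * ψ n + c n) := by
    have := ha n
    have := hb n
    have := hc n
    have := hψ n
    positivity
  have hterm (n : Fin N) : ConcaveOn ℝ {ψ : Fin N → ℝ | ∀ n, 0 < ψ n}
      (fun ψ => Real.log (1 + a n * ψ n / (b n * ψ n + c n))) := by
    refine ConcaveOn.log_of_pos ?_ fun ψ hψ => by linarith [hratio n ψ hψ]
    refine (concaveOn_const 1 hconv).add ?_
    exact ((concaveOn_mul_div_mul_add (ha n).le (hb n) (hc n)).comp_linearMap
      (LinearMap.proj n : (Fin N → ℝ) →ₗ[ℝ] ℝ)).subset (fun ψ hψ => hψ n) hconv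
  have hsum : ConcaveOn ℝ {ψ : Fin N → ℝ | ∀ n, 0 < ψ n}
      (fun ψ => ∑ n : Fin N, Real.log (1 + a n * ψ n / (b n * ψ n + c n))) := by
    refine ⟨hconv, fun x hx y hy u v hu hv huv => ?_⟩
    simp only [Finset.smul_sum, ← Finset.sum_add_distrib]
    exact Finset.sum_le_sum fun n _ => (hterm n).2 hx hy hu hv huv
  have hpos : ∀ ψ ∈ {ψ : Fin N → ℝ | ∀ n, 0 < ψ n},
      0 < ∑ n : Fin N, Real.log (1 + a n * ψ n / (b n * ψ n + c n)) := fun ψ hψ =>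
    Finset.sum_pos (fun n _ => Real.log_pos (by linarith [hratio n ψ hψ]))
      ⟨⟨0, hN⟩, Finset.mem_univ _⟩
  simpa only [div_eq_mul_inv, smul_eq_mul] using (hsum.convexOn_inv_of_pos hpos).smul hP.le
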